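/- arXiv:0803.4408 — 9 statements merged into one kernel-verified Lean document; each statement's English description precedes it below -/
import Mathlib

section
/- Let A be an associative unital ℂ-algebra, let n ≥ 1, and let s_1, …, s_{2n+1} be an anticommuting family of square roots of unity in A. Set ρ = (1/2)(1 + i^n s_1 s_2 ⋯ s_{2n+1}). Then the image of the unital subalgebra generated by s_1, …, s_{2n+1} under left multiplication by ρ coincides with the image of the unital subalgebra generated by s_1, …, s_{2n} under left multiplication by ρ; that is, { ρx : x ∈ Alg(s_1,…,s_{2n+1}) } = { ρy : y ∈ Alg(s_1,…,s_{2n}) } as subsets of A. -/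
/-- An element which commutes with each `f i` up to a scalar `ε i` commutes with the ordered
product of the `f i` up to the product of the `ε i`. -/
theorem mul_prod_ofFn_eq_prod_smul {A : Type*} [Ring A] {m : ℕ} (f : Fin m → A) (ε : Fin m → ℤ)
    (x : A) (h : ∀ i, x * f i = ε i • (f i * x)) :
    x * (List.ofFn f).prod = (∏ i, ε i) • ((List.ofFn f).prod * x) := by
  induction m with
  | zero => simp
  | succ m ih =>
    have ih' := ih (fun i => f i.succ) (fun i => ε i.succ) fun i => h i.succ
    rw [List.ofFn_succ, List.prod_cons, Fin.prod_univ_succ, ← mul_assoc, h 0, smul_mul_assoc,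
      mul_assoc, ih', mul_smul_comm, smul_smul, mul_assoc]

/-- The square of the ordered product of `m` anticommuting square roots of unity. -/
theorem prod_ofFn_mul_self_of_anticommute {A : Type*} [Ring A] {m : ℕ} (s : Fin m → A)
    (hsq : ∀ j, s j * s j = 1) (hanti : ∀ j k, j ≠ k → s j * s k = -(s k * s j)) :
    (List.ofFn s).prod * (List.ofFn s).prod = (-1) ^ ∑ i ∈ Finset.range m, i := by
  induction m with
  | zero => simp
  | succ m ih =>
    have ih' := ih (fun i => s i.succ) (fun j => hsq _)
      fun j k hjk => hanti _ _ ((Fin.succ_injective m).ne hjk)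
    have hcomm := mul_prod_ofFn_eq_prod_smul (fun i => s i.succ) (fun _ => -1) (s 0)
      fun i => by simpa using hanti 0 i.succ (Fin.succ_ne_zero i).symm
    rw [List.ofFn_succ, List.prod_cons]
    generalize (List.ofFn fun i => s i.succ).prod = R at ih' hcomm
    calc s 0 * R * (s 0 * R) = (s 0 * R) * s 0 * R := by simp only [mul_assoc]
      _ = (-1) ^ m * (R * (s 0 * s 0) * R) := by
        rw [hcomm]; simp [mul_assoc]
      _ = (-1) ^ ∑ i ∈ Finset.range (m + 1), i := by
        rw [hsq, mul_one, ih', ← pow_add, Finset.sum_range_succ, add_comm]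

/-- The ordered product of an odd number of anticommuting elements commutes with each of them. -/
theorem commute_prod_ofFn_of_anticommute {A : Type*} [Ring A] {n : ℕ} (s : Fin (2 * n + 1) → A)
    (hanti : ∀ j k, j ≠ k → s j * s k = -(s k * s j)) (j : Fin (2 * n + 1)) :
    Commute (s j) (List.ofFn s).prod := by
  have h := mul_prod_ofFn_eq_prod_smul s (fun i => if i = j then 1 else -1) (s j) fun i => by
    split_ifs with hij
    · simp [hij]
    · simpa using hanti j i (Ne.symm hij)
  have hprod : (∏ i : Fin (2 * n + 1), if i = j then (1 : ℤ) else -1) = 1 := by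
    simp [Finset.prod_ite, Finset.filter_ne', Finset.card_erase_of_mem]
  rwa [hprod, one_smul] at h

/-- The normalized product `i ^ n * s 1 * ⋯ * s (2n+1)` is an involution. -/
theorem I_pow_smul_prod_ofFn_mul_self {A : Type*} [Ring A] [Algebra ℂ A] {n : ℕ}
    (s : Fin (2 * n + 1) → A) (hsq : ∀ j, s j * s j = 1)
    (hanti : ∀ j k, j ≠ k → s j * s k = -(s k * s j)) :
    ((Complex.I ^ n) • (List.ofFn s).prod) * ((Complex.I ^ n) • (List.ofFn s).prod) = 1 := by
  have hsum : ∑ i ∈ Finset.range (2 * n + 1), i = n + 2 * (n * n) := by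
    have := Finset.sum_range_id_mul_two (2 * n + 1)
    rw [Nat.add_sub_cancel] at this
    linarith
  have hneg : ((-1 : A)) ^ n = ((-1 : ℂ) ^ n) • (1 : A) := by
    simp [Algebra.smul_def]
  rw [smul_mul_smul_comm, prod_ofFn_mul_self_of_anticommute s hsq hanti, hsum, pow_add,
    pow_mul, neg_one_sq, one_pow, mul_one, hneg, smul_smul, ← mul_pow, ← mul_pow,
    Complex.I_mul_I]
  simp

/-- Let `A` be an associative unital `ℂ`-algebra, `n ≥ 1`, and
`s 1, …, s (2n+1)` an anticommuting family of square roots of unity in `A`.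
Set `ρ = (1/2)(1 + i^n s 1 * ⋯ * s (2n+1))`.  Then
`{ρ * x : x ∈ Alg(s 1, …, s (2n+1))} = {ρ * y : y ∈ Alg(s 1, …, s (2n))}`,
where `Alg(…)` denotes the unital `ℂ`-subalgebra generated by the listed elements. -/
theorem rho_mul_adjoin_eq
    {A : Type*} [Ring A] [Algebra ℂ A]
    (n : ℕ) (hn : 1 ≤ n) (s : Fin (2 * n + 1) → A)
    (hsq : ∀ j, s j * s j = 1)
    (hanti : ∀ j k, j ≠ k → s j * s k = -(s k * s j)) :
    (fun x => (1 / 2 : ℂ) • (1 + (Complex.I ^ n) • (List.ofFn s).prod) * x) ''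
        (Algebra.adjoin ℂ (Set.range s) : Set A) =
      (fun y => (1 / 2 : ℂ) • (1 + (Complex.I ^ n) • (List.ofFn s).prod) * y) ''
        (Algebra.adjoin ℂ (Set.range fun j : Fin (2 * n) => s j.castSucc) : Set A) := by
  set ω : A := (Complex.I ^ n) • (List.ofFn s).prod with hω
  set ρ : A := (1 / 2 : ℂ) • (1 + ω) with hρ
  set B := Algebra.adjoin ℂ (Set.range fun j : Fin (2 * n) => s j.castSucc) with hB
  have hρω : ρ * ω = ρ := by
    rw [hρ, smul_mul_assoc, add_mul, one_mul, I_pow_smul_prod_ofFn_mul_self s hsq hanti, add_comm]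
  have hρs (j) : Commute ρ (s j) :=
    (((Commute.one_right _).add_right
      ((commute_prod_ofFn_of_anticommute s hanti j).smul_right _)).smul_right _).symm
  have hsB (j : Fin (2 * n)) : s j.castSucc ∈ B := Algebra.subset_adjoin ⟨j, rfl⟩
  have hρB {y : A} (hy : y ∈ B) : Commute ρ y :=
    Algebra.commute_of_mem_adjoin_of_forall_mem_commute hy (by rintro _ ⟨j, rfl⟩; exact hρs _)
  have hlast : ∃ y ∈ B, ρ * y = ρ * s (Fin.last _) := by
    refine ⟨(Complex.I ^ n) • (List.ofFn fun j : Fin (2 * n) => s j.castSucc).prod,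
      B.smul_mem (list_prod_mem fun x hx => ?_) _, ?_⟩
    · obtain ⟨j, rfl⟩ := (List.mem_ofFn' _ _).1 hx
      exact hsB j
    · have hωs : ω * s (Fin.last _) =
          (Complex.I ^ n) • (List.ofFn fun j : Fin (2 * n) => s j.castSucc).prod := by
        rw [hω, List.ofFn_succ', List.concat_eq_append, List.prod_append, List.prod_singleton,
          smul_mul_assoc, mul_assoc, hsq, mul_one]
      rw [← hωs, ← mul_assoc, hρω]
  apply Set.Subset.antisymm
  · rintro _ ⟨x, hx, rfl⟩
    change ∃ y ∈ B, ρ * y = ρ * x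
    induction hx using Algebra.adjoin_induction with
    | mem x hx =>
      obtain ⟨j, rfl⟩ := hx
      induction j using Fin.lastCases with
      | last => exact hlast
      | cast j => exact ⟨_, hsB j, rfl⟩
    | algebraMap r => exact ⟨_, B.algebraMap_mem r, rfl⟩
    | add x₁ x₂ _ _ h₁ h₂ =>
      obtain ⟨y₁, hy₁, e₁⟩ := h₁
      obtain ⟨y₂, hy₂, e₂⟩ := h₂
      exact ⟨y₁ + y₂, B.add_mem hy₁ hy₂, by rw [mul_add, mul_add, e₁, e₂]⟩
    | mul x₁ x₂ _ _ h₁ h₂ =>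
      obtain ⟨y₁, hy₁, e₁⟩ := h₁
      obtain ⟨y₂, hy₂, e₂⟩ := h₂
      refine ⟨y₁ * y₂, B.mul_mem hy₁ hy₂, ?_⟩
      rw [← mul_assoc ρ x₁, ← e₁, (hρB hy₁).eq, mul_assoc, ← e₂, ← mul_assoc, ← mul_assoc,
        (hρB hy₁).eq]
  · refine Set.image_mono (Algebra.adjoin_mono ?_)
    rintro _ ⟨j, rfl⟩
    exact ⟨_, rfl⟩
end

section
/- Let d ≥ 1 and let s_1, …, s_N be a spin system in M_d(ℂ). Define the linear map P : M_d(ℂ) → M_d(ℂ) by P(x) = (tr(x)/d)·1 + Σ_{j=1}^{N} (tr(s_j x)/d)·s_j. Then P maps positive semidefinite matrices to positive semidefinite matrices: if x ∈ M_d(ℂ) is positive semidefinite, then P(x) is positive semidefinite. -/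
open scoped ComplexOrder

/-- A linear combination of pairwise anticommuting involutions squares to the scalar
`∑ j, a j ^ 2`. -/
lemma sum_smul_mul_self_of_anticommute {ι n : Type*} [Fintype ι] [Fintype n]
    [DecidableEq n] (s : ι → Matrix n n ℂ) (hsq : ∀ j, s j * s j = 1)
    (hanti : ∀ j k, j ≠ k → s j * s k = -(s k * s j)) (a : ι → ℂ) :
    (∑ j, a j • s j) * (∑ j, a j • s j) = (∑ j, a j ^ 2) • (1 : Matrix n n ℂ) := by
  classical
  have expand : (∑ j, a j • s j) * (∑ j, a j • s j)
      = ∑ j, ∑ k, (a j * a k) • (s j * s k) := by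
    simp only [Finset.sum_mul_sum, smul_mul_smul_comm]
  have double : (∑ j, ∑ k, (a j * a k) • (s j * s k))
      + ∑ j, ∑ k, (a j * a k) • (s j * s k)
      = (2 : ℂ) • (∑ j, a j ^ 2) • (1 : Matrix n n ℂ) := by
    nth_rw 2 [Finset.sum_comm]
    rw [← Finset.sum_add_distrib]
    rw [Finset.sum_smul, Finset.smul_sum]
    conv_lhs => simp only [← Finset.sum_add_distrib]
    refine Finset.sum_congr rfl fun j _ => ?_
    rw [Finset.sum_eq_single j]
    · rw [hsq, ← two_smul ℂ, pow_two]
    · intro k _ hk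
      rw [hanti k j hk, mul_comm (a k), smul_neg, add_neg_cancel]
    · simp
  rw [expand]
  rw [← two_smul ℂ] at double
  exact smul_right_injective _ (two_ne_zero (α := ℂ)) double

/-- A Hermitian matrix whose square is the scalar `r ^ 2`, with `0 < r`, is at least `-r`. -/
lemma posSemidef_smul_one_add_of_mul_self {n : Type*} [Fintype n] [DecidableEq n]
    {S : Matrix n n ℂ} (hS : S.IsHermitian) {r : ℝ} (hr : 0 < r)
    (hSS : S * S = ((r : ℂ) ^ 2) • (1 : Matrix n n ℂ)) :
    ((r : ℂ) • (1 : Matrix n n ℂ) + S).PosSemidef := by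
  have hr0 : (r : ℂ) ≠ 0 := by exact_mod_cast hr.ne'
  have key : (r : ℂ) • (1 : Matrix n n ℂ) + S = ((2 * r : ℂ)⁻¹) •
      (((r : ℂ) • (1 : Matrix n n ℂ) + S).conjTranspose * ((r : ℂ) • (1 : Matrix n n ℂ) + S)) := by
    rw [Matrix.conjTranspose_add, hS.eq, Matrix.conjTranspose_smul, Matrix.conjTranspose_one,
      Complex.star_def, Complex.conj_ofReal, add_mul, mul_add, mul_add, hSS]
    simp only [smul_mul_assoc, mul_smul_comm, one_mul, mul_one]
    match_scalars <;> field_simp <;> ring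
  rw [key]
  refine (Matrix.posSemidef_conjTranspose_mul_self _).smul ?_
  have : (0 : ℝ) ≤ (2 * r)⁻¹ := by positivity
  exact_mod_cast this

/-- The trace of a product of two positive semidefinite matrices is nonnegative. -/
lemma trace_mul_nonneg_of_posSemidef {n : Type*} [Fintype n] [DecidableEq n]
    {A B : Matrix n n ℂ} (hA : A.PosSemidef) (hB : B.PosSemidef) :
    0 ≤ (A * B).trace := by
  obtain ⟨C, rfl⟩ : ∃ C : Matrix n n ℂ, A = C.conjTranspose * C := by
    open scoped MatrixOrder in
    exact CStarAlgebra.nonneg_iff_eq_star_mul_self.mp hA.nonneg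
  rw [mul_assoc, Matrix.trace_mul_comm]
  exact (hB.mul_mul_conjTranspose_same C).trace_nonneg

/-- The trace of a product of two Hermitian matrices is real. -/
lemma trace_mul_eq_ofReal_re_of_isHermitian {n : Type*} [Fintype n]
    {A B : Matrix n n ℂ} (hA : A.IsHermitian) (hB : B.IsHermitian) :
    (A * B).trace = ((A * B).trace.re : ℂ) := by
  refine (Complex.conj_eq_iff_re.mp ?_).symm
  rw [← Complex.star_def, ← Matrix.trace_conjTranspose, Matrix.conjTranspose_mul, hA.eq, hB.eq,
    Matrix.trace_mul_comm]

/-- Let `d ≥ 1` and let `s 1, …, s N` be a spin system in `M_d(ℂ)`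
(Hermitian matrices squaring to `1` and pairwise anticommuting).  The orthogonal
projection (for the trace inner product) onto the span of `1, s 1, …, s N`, namely
`P x = (tr x / d) • 1 + ∑ j, (tr (s j * x) / d) • s j`, maps positive semidefinite
matrices to positive semidefinite matrices. -/
theorem spin_projection_positive
    (d N : ℕ) (hd : 1 ≤ d) (s : Fin N → Matrix (Fin d) (Fin d) ℂ)
    (hsa : ∀ j, (s j).IsHermitian)
    (hsq : ∀ j, s j * s j = 1)
    (hanti : ∀ j k, j ≠ k → s j * s k = -(s k * s j))
    (x : Matrix (Fin d) (Fin d) ℂ) (hx : x.PosSemidef) :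
    ((Matrix.trace x / (d : ℂ)) • (1 : Matrix (Fin d) (Fin d) ℂ) +
        ∑ j, (Matrix.trace (s j * x) / (d : ℂ)) • s j).PosSemidef := by
  set a : Fin N → ℝ := fun j => (s j * x).trace.re with ha
  have hareal : ∀ j, (s j * x).trace = (a j : ℂ) := fun j =>
    trace_mul_eq_ofReal_re_of_isHermitian (hsa j) hx.isHermitian
  set S : Matrix (Fin d) (Fin d) ℂ := ∑ j, (a j : ℂ) • s j with hSdef
  have hfactor : (Matrix.trace x / (d : ℂ)) • (1 : Matrix (Fin d) (Fin d) ℂ) +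
      ∑ j, (Matrix.trace (s j * x) / (d : ℂ)) • s j
      = ((d : ℂ)⁻¹) • (x.trace • (1 : Matrix (Fin d) (Fin d) ℂ) + S) := by
    rw [smul_add, hSdef, Finset.smul_sum, smul_smul, div_eq_inv_mul]
    simp only [hareal, smul_smul, div_eq_inv_mul]
  have hd0 : (0 : ℂ) ≤ (d : ℂ)⁻¹ := by simp
  rw [hfactor]
  refine Matrix.PosSemidef.smul ?_ hd0
  have hS : S.IsHermitian := by
    rw [hSdef, Matrix.IsHermitian, Matrix.conjTranspose_sum]
    refine Finset.sum_congr rfl fun j _ => ?_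
    rw [Matrix.conjTranspose_smul, (hsa j).eq, Complex.star_def, Complex.conj_ofReal]
  set q : ℝ := ∑ j, a j ^ 2 with hq
  have hq0 : 0 ≤ q := Finset.sum_nonneg fun j _ => sq_nonneg _
  rcases hq0.eq_or_lt with hzero | hpos
  · have hazero : ∀ j, a j = 0 := fun j => by
      have := (Finset.sum_eq_zero_iff_of_nonneg (fun j _ => sq_nonneg (a j))).mp hzero.symm
        j (Finset.mem_univ j)
      exact pow_eq_zero_iff two_ne_zero |>.mp this
    have hSzero : S = 0 := by simp [hSdef, hazero]
    rw [hSzero, add_zero]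
    exact Matrix.PosSemidef.one.smul hx.trace_nonneg
  · set r : ℝ := √q with hrdef
    have hr : 0 < r := Real.sqrt_pos.mpr hpos
    have hrsq : (r : ℂ) ^ 2 = (q : ℂ) := by exact_mod_cast Real.sq_sqrt hq0
    have hSS : S * S = ((r : ℂ) ^ 2) • (1 : Matrix (Fin d) (Fin d) ℂ) := by
      rw [hSdef, sum_smul_mul_self_of_anticommute s hsq hanti, hrsq, hq]
      push_cast
      rfl
    have htrace : (S * x).trace = (r : ℂ) ^ 2 := by
      rw [hrsq, hSdef, hq, Finset.sum_mul, Matrix.trace_sum]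
      push_cast
      refine Finset.sum_congr rfl fun j _ => ?_
      rw [smul_mul_assoc, Matrix.trace_smul, hareal, smul_eq_mul, pow_two]
    have hplus := posSemidef_smul_one_add_of_mul_self hS hr hSS
    have hminus := posSemidef_smul_one_add_of_mul_self hS.neg hr (by rw [neg_mul_neg, hSS])
    have hbound := trace_mul_nonneg_of_posSemidef hminus hx
    have hprod : (0 : ℂ) ≤ (r : ℂ) * (x.trace - r) := by
      convert hbound using 1
      rw [add_mul, Matrix.trace_add, smul_mul_assoc, one_mul, neg_mul, Matrix.trace_neg,
        Matrix.trace_smul, htrace, smul_eq_mul]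
      ring
    have hle : (0 : ℂ) ≤ x.trace - r := by
      have hr0 : (r : ℂ) ≠ 0 := by exact_mod_cast hr.ne'
      have hrinv : (0 : ℂ) ≤ (r⁻¹ : ℝ) := Complex.zero_le_real.mpr (by positivity)
      have := mul_nonneg hrinv hprod
      rwa [Complex.ofReal_inv, inv_mul_cancel_left₀ hr0] at this
    have hsplit : x.trace • (1 : Matrix (Fin d) (Fin d) ℂ) + S
        = (x.trace - r) • (1 : Matrix (Fin d) (Fin d) ℂ)
          + ((r : ℂ) • (1 : Matrix (Fin d) (Fin d) ℂ) + S) := by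
      rw [← add_assoc, ← add_smul, sub_add_cancel]
    rw [hsplit]
    exact (Matrix.PosSemidef.one.smul hle).add hplus
end

section
/- Let n ≥ 1, let A be a nontrivial associative unital ℂ-algebra, and let s_1, …, s_{2n} be an anticommuting family of square roots of unity in A. Let Q be the quadratic form on ℂ^{2n} given by Q(x) = x_1^2 + ⋯ + x_{2n}^2. Then the linear map f : ℂ^{2n} → A, f(x) = x_1 s_1 + ⋯ + x_{2n} s_{2n}, satisfies f(x)^2 = Q(x)·1 for all x, and the induced ℂ-algebra homomorphism φ : Cl(Q) → A from the Clifford algebra Cl(Q) of Q, determined by φ(ι(x)) = f(x) for the canonical embedding ι : ℂ^{2n} → Cl(Q), is injective. -/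
section AnticommutingFamily

variable {ι A : Type*} [Ring A] {s : ι → A}

/-- Reordering a word in an anticommuting family changes its product at most by a sign. -/
theorem List.Perm.prod_map_eq_or_eq_neg_of_anticommute
    (hanti : ∀ j k, j ≠ k → s j * s k = -(s k * s j)) {l l' : List ι} (h : l.Perm l') :
    (l.map s).prod = (l'.map s).prod ∨ (l.map s).prod = -(l'.map s).prod := by
  induction h with
  | nil => simp
  | cons i _ ih => rcases ih with h | h <;> simp [h]
  | swap i j l =>
    by_cases hij : j = i
    · simp [hij]
    · right
      simp [← mul_assoc, hanti j i hij]
  | trans _ _ ih₁ ih₂ => rcases ih₁ with h₁ | h₁ <;> rcases ih₂ with h₂ | h₂ <;> simp [h₁, h₂]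

/-- Conjugating a word in an anticommuting family of square roots of unity by one of its members
multiplies it by an explicit sign. -/
theorem conj_prod_map_of_anticommute [DecidableEq ι] (hsq : ∀ j, s j * s j = 1)
    (hanti : ∀ j k, j ≠ k → s j * s k = -(s k * s j)) (j : ι) (l : List ι) :
    s j * (l.map s).prod * s j = (-1) ^ (l.length + l.count j) * (l.map s).prod := by
  induction l with
  | nil => simp [hsq]
  | cons i l ih =>
    have key : s j * (s i * (l.map s).prod) * s j =
        (if i = j then 1 else -1) * (s i * (s j * (l.map s).prod * s j)) := by
      split_ifs with h
      · simp [h, mul_assoc]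
      · simp only [← mul_assoc, hanti j i (Ne.symm h)]
        simp
    have hcomm (k : ℕ) : s i * (-1) ^ k = (-1) ^ k * s i :=
      ((Commute.neg_one_right _).pow_right k).eq
    rw [List.map_cons, List.prod_cons, key, ih, ← mul_assoc (s i), hcomm, List.length_cons,
      List.count_cons]
    by_cases h : i = j
    · simp [h, pow_add, mul_assoc]
    · simp [h, pow_add, mul_assoc]

theorem prod_map_ne_zero_of_mul_self_eq_one [Nontrivial A] (hsq : ∀ j, s j * s j = 1)
    (l : List ι) : (l.map s).prod ≠ 0 := by
  refine IsUnit.ne_zero (List.prod_isUnit fun a ha => ?_)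
  obtain ⟨j, -, rfl⟩ := List.mem_map.1 ha
  exact ⟨⟨s j, s j, hsq j, hsq j⟩, rfl⟩

/-- The products of the subsets of an anticommuting family of even size of square roots of unity
are linearly independent. -/
theorem linearIndependent_prod_map_of_anticommute {K : Type*} [Field K] [NeZero (2 : K)]
    [Algebra K A] [Nontrivial A] [Fintype ι] (hι : Even (Fintype.card ι))
    (hsq : ∀ j, s j * s j = 1) (hanti : ∀ j k, j ≠ k → s j * s k = -(s k * s j)) :
    LinearIndependent K fun T : Finset ι => (T.toList.map s).prod := by
  classical
  let conj (j : ι) : Module.End K A := LinearMap.mulLeftRight K (s j, s j)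
  have conj_apply (j : ι) (x : A) : conj j x = s j * x * s j := by simp [conj]
  have hcomm (i j : ι) : Commute (conj i) (conj j) := by
    ext x
    by_cases h : i = j
    · simp [h]
    · simp only [Module.End.mul_apply, conj_apply]
      calc s i * (s j * x * s j) * s i = s i * s j * x * (s j * s i) := by simp only [mul_assoc]
        _ = -(s j * s i) * x * -(s i * s j) := by rw [← hanti i j h, ← hanti j i (Ne.symm h)]
        _ = s j * (s i * x * s i) * s j := by simp only [neg_mul, mul_neg, neg_neg, mul_assoc]
  have hind := Module.End.independent_iInf_maxGenEigenspace_of_forall_mapsTo conj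
    fun i j φ => Module.End.mapsTo_maxGenEigenspace_of_comm (hcomm j i) φ
  let χ (T : Finset ι) (j : ι) : K := (-1) ^ (T.card + if j ∈ T then 1 else 0)
  have hne : (-1 : K) ≠ 1 := fun h => two_ne_zero (α := K) (by linear_combination -h)
  have hχ : Function.Injective χ := by
    intro S T h
    have hpar (j : ι) : (Even S.card ↔ Even T.card) ↔ (j ∈ S ↔ j ∈ T) := by
      have hj : Even (S.card + if j ∈ S then 1 else 0) ↔
          Even (T.card + if j ∈ T then 1 else 0) := by
        have hj := congrFun h j
        simp only [χ] at hj
        rcases Nat.even_or_odd (S.card + if j ∈ S then 1 else 0) with h₁ | h₁ <;>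
          rcases Nat.even_or_odd (T.card + if j ∈ T then 1 else 0) with h₂ | h₂
        · exact iff_of_true h₁ h₂
        · exact absurd (by rw [← h₂.neg_one_pow, ← hj, h₁.neg_one_pow]) hne
        · exact absurd (by rw [← h₁.neg_one_pow, hj, h₂.neg_one_pow]) hne
        · exact iff_of_false (Nat.not_even_iff_odd.2 h₁) (Nat.not_even_iff_odd.2 h₂)
      by_cases h₁ : j ∈ S <;> by_cases h₂ : j ∈ T <;>
        simp only [h₁, h₂, if_true, if_false, add_zero, Nat.even_add_one] at hj ⊢ <;> tauto
    by_cases hc : Even S.card ↔ Even T.card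
    · ext j
      exact (hpar j).1 hc
    · have hcompl : T = Sᶜ := by
        ext j
        have := mt (hpar j).2 hc
        rw [Finset.mem_compl]
        tauto
      have hcard := S.card_add_card_compl
      rw [← hcompl] at hcard
      rw [← hcard, Nat.even_add] at hι
      exact absurd hι hc
  refine (hind.comp hχ).linearIndependent _ (fun T => ?_)
    fun T => prod_map_ne_zero_of_mul_self_eq_one hsq _
  refine (Submodule.mem_iInf _).2 fun j => ?_
  refine (conj j).genEigenspace (χ T j) |>.monotone le_top (Module.End.mem_genEigenspace_one.2 ?_)
  rw [conj_apply, conj_prod_map_of_anticommute hsq hanti, Finset.length_toList,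
    T.nodup_toList.count, Algebra.smul_def]
  simp [χ]

/-- The span of the products of the subsets of an anticommuting family of square roots of unity is
stable under left multiplication by the members of the family. -/
theorem mul_prod_map_mem_span_of_anticommute {K : Type*} [CommRing K] [Algebra K A]
    (hsq : ∀ j, s j * s j = 1) (hanti : ∀ j k, j ≠ k → s j * s k = -(s k * s j))
    (j : ι) (T : Finset ι) :
    s j * (T.toList.map s).prod ∈
      Submodule.span K (Set.range fun T : Finset ι => (T.toList.map s).prod) := by
  classical
  have hmem (T : Finset ι) := Submodule.subset_span (R := K)
    (Set.mem_range_self (f := fun T : Finset ι => (T.toList.map s).prod) T)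
  by_cases hj : j ∈ T
  · have hperm := Finset.toList_insert (Finset.notMem_erase j T)
    rw [Finset.insert_erase hj] at hperm
    rcases hperm.prod_map_eq_or_eq_neg_of_anticommute hanti with h | h <;>
      rw [h, List.map_cons, List.prod_cons]
    · rw [← mul_assoc, hsq, one_mul]
      exact hmem _
    · rw [mul_neg, ← mul_assoc, hsq, one_mul]
      exact neg_mem (hmem _)
  · have hperm := (Finset.toList_insert hj).symm
    rw [← List.prod_cons, ← List.map_cons]
    rcases hperm.prod_map_eq_or_eq_neg_of_anticommute hanti with h | h <;> rw [h]
    · exact hmem _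
    · exact neg_mem (hmem _)

/-- Linear combinations of an anticommuting family of square roots of unity square to scalars. -/
theorem sum_smul_mul_self_of_anticommute_s9 {K : Type*} [CommRing K] [Algebra K A]
    (hsq : ∀ j, s j * s j = 1) (hanti : ∀ j k, j ≠ k → s j * s k = -(s k * s j))
    (x : ι → K) (T : Finset ι) :
    (∑ j ∈ T, x j • s j) * ∑ j ∈ T, x j • s j = algebraMap K A (∑ j ∈ T, x j * x j) := by
  classical
  induction T using Finset.induction_on with
  | empty => simp
  | insert i T hi ih =>
    have hswap : s i * ∑ j ∈ T, x j • s j = -((∑ j ∈ T, x j • s j) * s i) := by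
      rw [Finset.mul_sum, Finset.sum_mul, ← Finset.sum_neg_distrib]
      refine Finset.sum_congr rfl fun j hj => ?_
      rw [mul_smul_comm, smul_mul_assoc, hanti i j (ne_of_mem_of_not_mem hj hi).symm, smul_neg]
    rw [Finset.sum_insert hi, Finset.sum_insert hi, map_add, ← ih, add_mul, mul_add, mul_add,
      smul_mul_assoc _ _ (∑ j ∈ T, x j • s j), hswap, smul_mul_smul_comm, hsq, mul_smul_comm,
      Algebra.algebraMap_eq_smul_one, smul_neg]
    abel

end AnticommutingFamily

/-- A Clifford algebra is spanned by the products of the subsets of an orthonormal basis. -/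
theorem CliffordAlgebra.span_prod_map_ι_eq_top {K M κ : Type*} [CommRing K] [AddCommGroup M]
    [Module K M] {Q : QuadraticForm K M} (b : Module.Basis κ K M) (hQ : ∀ j, Q (b j) = 1)
    (hortho : ∀ j k, j ≠ k → Q.IsOrtho (b j) (b k)) :
    Submodule.span K (Set.range fun T : Finset κ =>
      (T.toList.map fun j => CliffordAlgebra.ι Q (b j)).prod) = ⊤ := by
  set e : κ → CliffordAlgebra Q := fun j => CliffordAlgebra.ι Q (b j)
  have hsq (j : κ) : e j * e j = 1 := by simp [e, hQ]
  have hanti (j k : κ) (h : j ≠ k) : e j * e k = -(e k * e j) :=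
    CliffordAlgebra.ι_mul_ι_comm_of_isOrtho (hortho j k h)
  set V := Submodule.span K (Set.range fun T : Finset κ => (T.toList.map e).prod)
  have hone : (1 : CliffordAlgebra Q) ∈ V := Submodule.subset_span ⟨∅, by simp⟩
  have hmul (j : κ) (x : CliffordAlgebra Q) (hx : x ∈ V) : e j * x ∈ V := by
    induction hx using Submodule.span_induction with
    | mem x hx =>
      obtain ⟨T, rfl⟩ := hx
      exact mul_prod_map_mem_span_of_anticommute hsq hanti j T
    | zero => simp
    | add x y _ _ hx hy => rw [mul_add]; exact add_mem hx hy
    | smul c x _ hx => rw [mul_smul_comm]; exact V.smul_mem c hx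
  refine eq_top_iff.2 fun x _ => ?_
  induction x using CliffordAlgebra.left_induction with
  | algebraMap r => rw [Algebra.algebraMap_eq_smul_one]; exact V.smul_mem r hone
  | add x y hx hy => exact add_mem (hx trivial) (hy trivial)
  | ι_mul x m hx =>
    induction b.mem_span m using Submodule.span_induction with
    | mem _ h => obtain ⟨j, rfl⟩ := h; exact hmul j x (hx trivial)
    | zero => simp
    | add _ _ _ _ h₁ h₂ => rw [map_add, add_mul]; exact add_mem (h₁ trivial) (h₂ trivial)
    | smul c _ _ h => rw [map_smul, smul_mul_assoc]; exact V.smul_mem c (h trivial)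

/-- Let `n ≥ 1`, `A` a nontrivial associative unital `ℂ`-algebra,
and `s 1, …, s (2n)` an anticommuting family of square roots of unity in `A`.
Let `Q` be the quadratic form `Q x = x 1 ^ 2 + ⋯ + x (2n) ^ 2` on `ℂ^(2n)`.
Then the linear map `f x = ∑ j, x j • s j` satisfies `f x * f x = Q x • 1`, and the
induced `ℂ`-algebra homomorphism `Cl(Q) → A` (determined by `φ (ι x) = f x`) is
injective. -/
theorem clifford_map_from_anticommuting_injective
    (n : ℕ) (hn : 1 ≤ n) {A : Type*} [Ring A] [Algebra ℂ A] [Nontrivial A]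
    (s : Fin (2 * n) → A)
    (hsq : ∀ j, s j * s j = 1)
    (hanti : ∀ j k, j ≠ k → s j * s k = -(s k * s j)) :
    let Q : QuadraticForm ℂ (Fin (2 * n) → ℂ) :=
      QuadraticMap.weightedSumSquares ℂ (fun _ : Fin (2 * n) => (1 : ℂ))
    let f : (Fin (2 * n) → ℂ) →ₗ[ℂ] A :=
      ∑ j, (LinearMap.proj j : (Fin (2 * n) → ℂ) →ₗ[ℂ] ℂ).smulRight (s j)
    (∀ x, f x * f x = algebraMap ℂ A (Q x)) ∧
      ∀ hf : ∀ x, f x * f x = algebraMap ℂ A (Q x),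
        Function.Injective (CliffordAlgebra.lift Q ⟨f, hf⟩) := by
  intro Q f
  have hf_apply (x : Fin (2 * n) → ℂ) : f x = ∑ j, x j • s j := by simp [f]
  have hf_single (j : Fin (2 * n)) : f (Pi.single j 1) = s j := by
    simp [hf_apply, Pi.single_apply]
  have hQ (x : Fin (2 * n) → ℂ) : Q x = ∑ j, x j * x j := by
    simp [Q, QuadraticMap.weightedSumSquares_apply]
  refine ⟨fun x => ?_, fun hf => ?_⟩
  · rw [hf_apply, hQ]
    exact sum_smul_mul_self_of_anticommute_s9 hsq hanti x _
  · set b := Pi.basisFun ℂ (Fin (2 * n))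
    have hspan := CliffordAlgebra.span_prod_map_ι_eq_top (Q := Q) b
      (fun j => by simp [b, hQ, Pi.single_apply])
      (fun j k h => by
        rw [QuadraticMap.isOrtho_def, hQ, hQ, hQ, ← Finset.sum_add_distrib]
        refine Finset.sum_congr rfl fun i _ => ?_
        by_cases h₁ : i = j <;> by_cases h₂ : i = k <;> simp_all [b, Pi.single_apply])
    let φ := (CliffordAlgebra.lift Q ⟨f, hf⟩).toLinearMap
    have hφ : (fun T : Finset (Fin (2 * n)) => (T.toList.map s).prod) =
        φ ∘ fun T => (T.toList.map fun j => CliffordAlgebra.ι Q (b j)).prod := by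
      funext T
      simp [φ, b, map_list_prod, Function.comp_def, hf_single]
    have hlin := linearIndependent_prod_map_of_anticommute (K := ℂ) (by simp) hsq hanti
    rw [hφ] at hlin
    have hdisj := Submodule.range_ker_disjoint hlin
    rw [hspan, disjoint_comm, disjoint_top] at hdisj
    exact LinearMap.ker_eq_bot.1 hdisj
end

section
/- Let n ≥ 1. Then n · Σ_{θ ∈ D_{2n}} |1 + S(θ) + (−1)^n π(θ)| = (n+1) · Σ_{θ ∈ D_{2n}} |1 + S(θ) − (−1)^n π(θ)|. Equivalently, the ratio of the two L^1-norms of the functions g = 1 + Σ_{j=1}^{2n} ε_j + (−1)^n Π_{j=1}^{2n} ε_j and f = 1 + Σ_{j=1}^{2n} ε_j − (−1)^n Π_{j=1}^{2n} ε_j on the uniform probability space D_{2n} equals (n+1)/n. -/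
/-- A sum over sign vectors of a function of the coordinate sum and the coordinate product is a
binomial sum over the number of positive coordinates. -/
theorem sum_piFinset_signs (N : ℕ) (F : ℤ → ℤ → ℤ) :
    ∑ θ ∈ Fintype.piFinset (fun _ : Fin N => ({-1, 1} : Finset ℤ)), F (∑ j, θ j) (∏ j, θ j) =
      ∑ k ∈ Finset.range (N + 1), (N.choose k : ℤ) * F (2 * k - N) ((-1) ^ (N - k)) := by
  have h := Finset.sum_powerset_apply_card
    (fun k : ℕ => F (2 * k - N) ((-1) ^ (N - k))) (x := (Finset.univ : Finset (Fin N)))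
  simp only [Finset.card_univ, Fintype.card_fin, nsmul_eq_mul] at h
  rw [← h]
  symm
  refine Finset.sum_nbij' (fun s j => if j ∈ s then 1 else -1)
    (fun θ => Finset.univ.filter (fun j => θ j = 1)) ?_ ?_ ?_ ?_ ?_
  · intro s _
    simp only [Fintype.mem_piFinset]
    intro j
    split_ifs <;> simp
  · simp
  · intro s _
    ext j
    simp
  · intro θ hθ
    ext j
    have hj := Fintype.mem_piFinset.mp hθ j
    simp only [Finset.mem_insert, Finset.mem_singleton] at hj
    rcases hj with hj | hj <;> simp [hj]
  · intro s _
    have hc : (Finset.univ.filter (fun j => j ∉ s)).card = N - s.card := by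
      rw [Finset.filter_not, Finset.filter_univ_mem, ← Finset.compl_eq_univ_sdiff,
        Finset.card_compl, Fintype.card_fin]
    have hle : s.card ≤ N := by simpa using s.card_le_univ
    congr 1
    · rw [Finset.sum_ite, Finset.sum_const, Finset.sum_const, hc, Finset.filter_univ_mem]
      simp only [nsmul_eq_mul]
      push_cast [hle]
      ring
    · rw [Finset.prod_ite, Finset.prod_const, Finset.prod_const, hc]
      simp

/-- A sum over `0, …, 2n` folded about its middle term. -/
theorem sum_range_two_mul_add_one_fold (n : ℕ) (G : ℕ → ℤ) :
    ∑ k ∈ Finset.range (2 * n + 1), G k =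
      ∑ k ∈ Finset.range n, (G k + G (2 * n - k)) + G n := by
  rw [show 2 * n + 1 = n + (n + 1) by ring, Finset.sum_range_add, Finset.sum_range_succ',
    Finset.sum_add_distrib, ← Finset.sum_range_reflect (fun x => G (n + (x + 1))), add_assoc]
  congr 2
  refine Finset.sum_congr rfl fun k hk => ?_
  rw [Finset.mem_range] at hk
  congr 1
  omega

/-- Partial sums of `(N - 2k) * N.choose k` telescope. -/
theorem sum_range_choose_mul_sub (N K : ℕ) :
    ∑ k ∈ Finset.range K, (N.choose k : ℤ) * (N - 2 * k) = K * N.choose K := by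
  induction K with
  | zero => simp
  | succ K ih =>
    rw [Finset.sum_range_succ, ih]
    rcases le_or_gt K N with h | h
    · have h1 := congrArg (Nat.cast : ℕ → ℤ) (Nat.choose_succ_right_eq N K)
      push_cast [h] at h1 ⊢
      linarith
    · simp [Nat.choose_eq_zero_of_lt h, Nat.choose_eq_zero_of_lt (h.trans K.lt_succ_self)]

/-- The contribution of the sign vectors with `i` positive coordinates to the difference of the
two sides of the norm identity. -/
def normDefect (n i : ℕ) : ℤ :=
  (n : ℤ) * (((2 * n).choose i : ℤ) *
      |1 + (2 * (i : ℤ) - (2 * n : ℕ)) + (-1) ^ n * (-1) ^ (2 * n - i)|) -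
    ((n : ℤ) + 1) * (((2 * n).choose i : ℤ) *
      |1 + (2 * (i : ℤ) - (2 * n : ℕ)) - (-1) ^ n * (-1) ^ (2 * n - i)|)

theorem normDefect_self (n : ℕ) : normDefect n n = 2 * n * (2 * n).choose n := by
  have hsign : (-1 : ℤ) ^ n * (-1) ^ (2 * n - n) = 1 := by
    rw [show 2 * n - n = n by omega, ← mul_pow]
    simp
  rw [normDefect, hsign]
  push_cast
  norm_num
  ring

theorem normDefect_add_reflect {n k : ℕ} (hk : k < n) :
    normDefect n k + normDefect n (2 * n - k) =
      (-2) * (((2 * n).choose k : ℤ) * ((2 * n : ℕ) - 2 * k)) := by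
  obtain ⟨d, rfl⟩ := Nat.exists_eq_add_of_le hk.le
  have hd : 0 < d := by omega
  have hsq : (-1 : ℤ) ^ k * (-1) ^ k = 1 := by rw [← mul_pow]; simp
  have hsq' : (-1 : ℤ) ^ d * (-1) ^ d = 1 := by rw [← mul_pow]; simp
  have hsign : (-1 : ℤ) ^ (k + d) * (-1) ^ (2 * (k + d) - k) = (-1) ^ d := by
    rw [show 2 * (k + d) - k = k + d + d by omega]
    simp only [pow_add]
    linear_combination (-1 : ℤ) ^ d * ((-1) ^ d * (-1) ^ d * hsq + hsq')
  have hsign' : (-1 : ℤ) ^ (k + d) * (-1) ^ (2 * (k + d) - (2 * (k + d) - k)) = (-1) ^ d := by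
    rw [show 2 * (k + d) - (2 * (k + d) - k) = k by omega, pow_add]
    linear_combination (-1 : ℤ) ^ d * hsq
  have hchoose : (2 * (k + d)).choose (2 * (k + d) - k) = (2 * (k + d)).choose k :=
    Nat.choose_symm (by omega)
  have hd' : (1 : ℤ) ≤ d := by exact_mod_cast hd
  have hcast : ((2 * (k + d) - k : ℕ) : ℤ) = k + 2 * d := by omega
  simp only [normDefect, hsign, hsign', hchoose, hcast]
  push_cast
  rcases neg_one_pow_eq_or ℤ d with h | h <;> rw [h]
  all_goals
    rw [abs_of_nonpos (by linarith), abs_of_nonpos (by linarith), abs_of_nonneg (by linarith),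
      abs_of_nonneg (by linarith)]
    ring

/-- Let `n ≥ 1`.  Summing over all sign tuples `θ ∈ {-1,1}^{2n}`,
with `S θ = θ 1 + ⋯ + θ (2n)` and `π θ = θ 1 ⋯ θ (2n)`, we have
`n * ∑_θ |1 + S θ + (-1)^n π θ| = (n + 1) * ∑_θ |1 + S θ - (-1)^n π θ|`;
i.e. the ratio of the `L¹`-norms of `g = 1 + ∑ εⱼ + (-1)^n ∏ εⱼ` and
`f = 1 + ∑ εⱼ - (-1)^n ∏ εⱼ` on the uniform probability space `D_{2n}` is
`(n+1)/n`. -/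
theorem l1_norm_ratio_spin_transpose
    (n : ℕ) (hn : 1 ≤ n) :
    (n : ℤ) * ∑ θ ∈ Fintype.piFinset (fun _ : Fin (2 * n) => ({-1, 1} : Finset ℤ)),
        |1 + (∑ j, θ j) + (-1) ^ n * ∏ j, θ j| =
      ((n : ℤ) + 1) * ∑ θ ∈ Fintype.piFinset (fun _ : Fin (2 * n) => ({-1, 1} : Finset ℤ)),
        |1 + (∑ j, θ j) - (-1) ^ n * ∏ j, θ j| := by
  rw [sum_piFinset_signs (2 * n) (fun a b => |1 + a + (-1) ^ n * b|),
    sum_piFinset_signs (2 * n) (fun a b => |1 + a - (-1) ^ n * b|), Finset.mul_sum,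
    Finset.mul_sum, ← sub_eq_zero, ← Finset.sum_sub_distrib]
  change ∑ k ∈ Finset.range (2 * n + 1), normDefect n k = 0
  rw [sum_range_two_mul_add_one_fold, normDefect_self,
    Finset.sum_congr rfl fun k hk => normDefect_add_reflect (Finset.mem_range.mp hk),
    ← Finset.mul_sum, sum_range_choose_mul_sub]
  ring
end

section
/- Let n ≥ 1 and for θ ∈ D_{2n} set f(θ) = 1 + S(θ) − (−1)^n π(θ). Then: (a) f(θ) is an integer divisible by 4 for every θ; (b) for every θ and every i ∈ {1, …, 2n}, f(θ) · f(σ_i θ) ≥ 0, where σ_i θ is θ with its i-th coordinate negated; and (c) for every θ, f(θ) · (−f(−θ)) ≥ 0, where −θ is θ with all coordinates negated. -/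
theorem exists_sum_eq_card_sub_two_mul_and_prod_eq_neg_one_pow {ι : Type*} (s : Finset ι)
    (θ : ι → ℤ) (hθ : ∀ i ∈ s, θ i = -1 ∨ θ i = 1) :
    ∃ k : ℕ, ∑ i ∈ s, θ i = s.card - 2 * k ∧ ∏ i ∈ s, θ i = (-1) ^ k := by
  classical
  induction s using Finset.induction_on with
  | empty => exact ⟨0, by simp⟩
  | insert a s ha ih =>
    obtain ⟨k, hS, hP⟩ := ih fun i hi => hθ i (Finset.mem_insert_of_mem hi)
    rw [Finset.sum_insert ha, Finset.prod_insert ha, Finset.card_insert_of_notMem ha, hS, hP]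
    rcases hθ a (Finset.mem_insert_self a s) with h | h
    · exact ⟨k + 1, by rw [h]; push_cast; ring, by rw [h]; ring⟩
    · exact ⟨k, by rw [h]; push_cast; ring, by rw [h]; ring⟩

theorem four_dvd_one_add_two_mul_sub_neg_one_pow (n k : ℕ) :
    (4 : ℤ) ∣ 1 + (2 * n - 2 * k) - (-1) ^ n * (-1) ^ k := by
  rcases Nat.even_or_odd n with hn | hn <;> rcases Nat.even_or_odd k with hk | hk <;>
    rw [hn.neg_one_pow, hk.neg_one_pow] <;> obtain ⟨a, rfl⟩ := hn <;>
    obtain ⟨b, rfl⟩ := hk <;> push_cast <;> omega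

theorem mul_nonneg_of_four_dvd_of_abs_sub_le {x y : ℤ} (hx : 4 ∣ x) (h : |y - x| ≤ 4) :
    0 ≤ x * y := by
  rw [abs_le] at h
  rcases lt_trichotomy x 0 with h0 | rfl | h0
  · exact mul_nonneg_of_nonpos_of_nonpos h0.le (by omega)
  · simp
  · exact mul_nonneg h0.le (by omega)

/-- Let `n ≥ 1` and, for a sign tuple `θ ∈ {-1,1}^{2n}`, set
`f θ = 1 + S θ - (-1)^n * π θ` where `S θ` is the sum and `π θ` the product of the
coordinates.  Then (a) `4 ∣ f θ`; (b) `f θ * f (σᵢ θ) ≥ 0` for every coordinate flip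
`σᵢ`; and (c) `f θ * (-(f (-θ))) ≥ 0` where `-θ` negates all coordinates. -/
theorem sign_function_f_properties
    (n : ℕ) (hn : 1 ≤ n) :
    let D : Finset (Fin (2 * n) → ℤ) :=
      Fintype.piFinset fun _ : Fin (2 * n) => ({-1, 1} : Finset ℤ)
    let f : (Fin (2 * n) → ℤ) → ℤ := fun θ => 1 + (∑ j, θ j) - (-1) ^ n * ∏ j, θ j
    (∀ θ ∈ D, (4 : ℤ) ∣ f θ) ∧
      (∀ θ ∈ D, ∀ i : Fin (2 * n), 0 ≤ f θ * f (Function.update θ i (-(θ i)))) ∧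
      (∀ θ ∈ D, 0 ≤ f θ * (-(f fun j => -(θ j)))) := by
  intro D f
  have mem {θ : Fin (2 * n) → ℤ} (hθ : θ ∈ D) (i : Fin (2 * n)) : θ i = -1 ∨ θ i = 1 := by
    simpa using Fintype.mem_piFinset.mp hθ i
  have dvd : ∀ θ ∈ D, (4 : ℤ) ∣ f θ := by
    intro θ hθ
    obtain ⟨k, hS, hP⟩ := exists_sum_eq_card_sub_two_mul_and_prod_eq_neg_one_pow
      Finset.univ θ fun i _ => mem hθ i
    simp only [f]
    rw [hS, hP, Finset.card_univ, Fintype.card_fin]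
    push_cast
    exact four_dvd_one_add_two_mul_sub_neg_one_pow n k
  have sign {θ : Fin (2 * n) → ℤ} (hθ : θ ∈ D) :
      (-1) ^ n * ∏ j, θ j = 1 ∨ (-1) ^ n * ∏ j, θ j = -1 := by
    obtain ⟨k, -, hP⟩ := exists_sum_eq_card_sub_two_mul_and_prod_eq_neg_one_pow
      Finset.univ θ fun i _ => mem hθ i
    rw [hP, ← pow_add]
    exact neg_one_pow_eq_or ℤ _
  refine ⟨dvd, fun θ hθ i => ?_, fun θ hθ => ?_⟩
  · apply mul_nonneg_of_four_dvd_of_abs_sub_le (dvd θ hθ)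
    have hS : ∑ j, Function.update θ i (-(θ i)) j = ∑ j, θ j - 2 * θ i := by
      rw [Finset.sum_update_of_mem (Finset.mem_univ i),
        ← Finset.add_sum_erase _ θ (Finset.mem_univ i), Finset.sdiff_singleton_eq_erase]
      ring
    have hP : ∏ j, Function.update θ i (-(θ i)) j = -∏ j, θ j := by
      rw [Finset.prod_update_of_mem (Finset.mem_univ i),
        ← Finset.mul_prod_erase _ θ (Finset.mem_univ i), Finset.sdiff_singleton_eq_erase]
      ring
    simp only [f]
    rw [hS, hP, mul_neg, abs_le]
    rcases mem hθ i with h | h <;> rcases sign hθ with h' | h' <;> rw [h, h'] <;>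
      constructor <;> linarith
  · apply mul_nonneg_of_four_dvd_of_abs_sub_le (dvd θ hθ)
    have hP : ∏ j, -θ j = ∏ j, θ j := by
      rw [Finset.prod_neg]
      simp
    simp only [f]
    rw [Finset.sum_neg_distrib, hP, abs_le]
    rcases sign hθ with h' | h' <;> rw [h'] <;> constructor <;> linarith
end

section
/- Let n ≥ 1 and let q be an integer with q > n. Then Σ_{θ ∈ D_{2n}} π(θ) · (1 + S(θ))^{2q−1} > 0. (This is the coefficient c_1 > 0 showing that the polynomial t ↦ Σ_{θ ∈ D_{2n}} |1 + S(θ) + t π(θ)|^{2q} is not an even function of t when q > n.) -/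
/-- The sum of `π θ * (a + S θ) ^ m` over all sign tuples `θ` of length `k`, that is, the `k`-fold
central difference of `x ↦ x ^ m` at `a`. -/
def signedPowerSum (k m : ℕ) (a : ℤ) : ℤ :=
  ∑ θ ∈ Fintype.piFinset (fun _ : Fin k => ({-1, 1} : Finset ℤ)),
    (∏ j, θ j) * (a + ∑ j, θ j) ^ m

theorem sum_piFinset_succ {M α : Type*} [AddCommMonoid M] [DecidableEq α] (k : ℕ) (s : Finset α)
    (f : (Fin (k + 1) → α) → M) :
    ∑ θ ∈ Fintype.piFinset (fun _ : Fin (k + 1) => s), f θ =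
      ∑ x ∈ s, ∑ θ ∈ Fintype.piFinset (fun _ : Fin k => s), f (Fin.cons x θ) := by
  rw [← Finset.sum_product']
  refine Finset.sum_nbij' (fun θ => (θ 0, Fin.tail θ)) (fun p => Fin.cons p.1 p.2) ?_ ?_ ?_ ?_ ?_
  · intro θ hθ
    rw [Fintype.mem_piFinset] at hθ
    simpa [Fin.tail] using ⟨hθ 0, fun i => hθ i.succ⟩
  · rintro ⟨x, θ⟩ h
    simpa [Fin.forall_fin_succ] using h
  all_goals simp

theorem signedPowerSum_succ_eq_sub (k m : ℕ) (a : ℤ) :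
    signedPowerSum (k + 1) m a = signedPowerSum k m (a + 1) - signedPowerSum k m (a - 1) := by
  simp only [signedPowerSum]
  rw [sum_piFinset_succ, Finset.sum_pair (by norm_num), sub_eq_neg_add, ← Finset.sum_neg_distrib]
  simp [Fin.prod_univ_succ, Fin.sum_univ_succ, sub_eq_add_neg, add_assoc]

theorem signedPowerSum_succ (k m : ℕ) (a : ℤ) :
    signedPowerSum (k + 1) m a =
      ∑ i ∈ Finset.range (m + 1), (1 - (-1) ^ (m - i)) * (m.choose i : ℤ) * signedPowerSum k i a := by
  rw [signedPowerSum_succ_eq_sub]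
  simp only [signedPowerSum, Finset.mul_sum]
  rw [Finset.sum_comm, ← Finset.sum_sub_distrib]
  refine Finset.sum_congr rfl fun θ _ => ?_
  rw [show a + 1 + ∑ j, θ j = (a + ∑ j, θ j) + 1 by ring,
    show a - 1 + ∑ j, θ j = (a + ∑ j, θ j) + (-1) by ring, add_pow, add_pow, ← mul_sub,
    ← Finset.sum_sub_distrib, Finset.mul_sum]
  refine Finset.sum_congr rfl fun i _ => ?_
  rw [one_pow]
  ring

theorem one_sub_neg_one_pow_nonneg (n : ℕ) : (0 : ℤ) ≤ 1 - (-1) ^ n := by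
  rcases neg_one_pow_eq_or ℤ n with h | h <;> simp [h]

theorem signedPowerSum_nonneg (k m : ℕ) {a : ℤ} (ha : 0 ≤ a) : 0 ≤ signedPowerSum k m a := by
  induction k generalizing m with
  | zero => simpa [signedPowerSum] using pow_nonneg ha m
  | succ k ih =>
    rw [signedPowerSum_succ]
    exact Finset.sum_nonneg fun i _ =>
      mul_nonneg (mul_nonneg (one_sub_neg_one_pow_nonneg _) (by positivity)) (ih i)

theorem signedPowerSum_pos {k m : ℕ} (hkm : k ≤ m) {a : ℤ} (ha : 0 < a) :
    0 < signedPowerSum k m a := by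
  induction k generalizing m with
  | zero => simpa [signedPowerSum] using pow_pos ha m
  | succ k ih =>
    obtain ⟨m, rfl⟩ : ∃ l, m = l + 1 := ⟨m - 1, by omega⟩
    rw [signedPowerSum_succ]
    refine Finset.sum_pos' (fun i _ => mul_nonneg
      (mul_nonneg (one_sub_neg_one_pow_nonneg _) (by positivity))
      (signedPowerSum_nonneg k i ha.le)) ⟨m, by simp, mul_pos ?_ (ih (by omega))⟩
    rw [Nat.add_sub_cancel_left, Nat.choose_succ_self_right]
    norm_num

/-- Let `n ≥ 1` and let `q` be an integer with `q > n`.  Then,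
summing over all sign tuples `θ ∈ {-1,1}^{2n}`, with `S θ` the sum and `π θ` the
product of the coordinates, `∑_θ π θ * (1 + S θ)^(2q - 1) > 0`.  (This is the
positivity of the degree-one coefficient showing that
`t ↦ ∑_θ |1 + S θ + t * π θ|^{2q}` is not an even polynomial when `q > n`.) -/
theorem odd_coefficient_positive
    (n q : ℕ) (hn : 1 ≤ n) (hq : n < q) :
    0 < ∑ θ ∈ Fintype.piFinset (fun _ : Fin (2 * n) => ({-1, 1} : Finset ℤ)),
        (∏ j, θ j) * (1 + ∑ j, θ j) ^ (2 * q - 1) := by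
  exact signedPowerSum_pos (by omega) one_pos
end

section
/- Let Z be a reflexive real Banach space (the canonical embedding of Z into its bidual is surjective), let G be a group admitting a left-invariant mean m, and let λ : G → Isom(Z) be a group homomorphism into the group of surjective linear isometries of Z. Let X ⊆ Z be a closed subspace invariant under λ (λ(g)(X) ⊆ X for all g ∈ G), and let v : Z → Z be a bounded linear map whose restriction to X is a multiplier, i.e. λ(g)(v(x)) = v(λ(g)x) for all g ∈ G and x ∈ X. Then there exists a bounded linear map w : Z → Z such that ‖w‖ ≤ ‖v‖, w is a multiplier (λ(g)(w(z)) = w(λ(g)z) for all g ∈ G and z ∈ Z), and w(x) = v(x) for all x ∈ X. -/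
open BoundedContinuousFunction in
/-- A positive normalized functional on bounded functions is a contraction. -/
theorem abs_mean_le_norm {G : Type*} [TopologicalSpace G]
    (m : BoundedContinuousFunction G ℝ →ₗ[ℝ] ℝ) (hm1 : m 1 = 1)
    (hmpos : ∀ f : BoundedContinuousFunction G ℝ, (∀ g, 0 ≤ f g) → 0 ≤ m f)
    (f : BoundedContinuousFunction G ℝ) : |m f| ≤ ‖f‖ := by
  have hbound (g : G) : |f g| ≤ ‖f‖ := f.norm_coe_le_norm g
  have hupper := hmpos (‖f‖ • 1 - f) fun g => by
    simpa using (abs_le.mp (hbound g)).2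
  have hlower := hmpos (‖f‖ • 1 + f) fun g => by
    have := (abs_le.mp (hbound g)).1
    simp only [coe_add, coe_smul, Pi.add_apply, coe_one, Pi.one_apply, smul_eq_mul]
    linarith
  simp only [map_sub, map_add, map_smul, hm1, smul_eq_mul, mul_one] at hupper hlower
  exact abs_le.mpr ⟨by linarith, by linarith⟩

section ConjugateAverage

variable {Z : Type*} [NormedAddCommGroup Z] [NormedSpace ℝ Z]
  {G : Type*} [Group G]

theorem norm_apply_conjugate_le (lam : G →* (Z ≃ₗᵢ[ℝ] Z)) (v : Z →L[ℝ] Z) (z : Z)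
    (φ : StrongDual ℝ Z) (g : G) :
    ‖φ (lam g (v (lam g⁻¹ z)))‖ ≤ ‖v‖ * ‖z‖ * ‖φ‖ := by
  calc ‖φ (lam g (v (lam g⁻¹ z)))‖ ≤ ‖φ‖ * ‖lam g (v (lam g⁻¹ z))‖ := φ.le_opNorm _
    _ = ‖φ‖ * ‖v (lam g⁻¹ z)‖ := by rw [LinearIsometryEquiv.norm_map]
    _ ≤ ‖φ‖ * (‖v‖ * ‖lam g⁻¹ z‖) := by gcongr; exact v.le_opNorm _
    _ = ‖v‖ * ‖z‖ * ‖φ‖ := by rw [LinearIsometryEquiv.norm_map]; ring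

variable [TopologicalSpace G] [DiscreteTopology G]

/-- The coefficient function `g ↦ φ (lam g (v (lam g⁻¹ z)))`. -/
noncomputable def conjugateCoeff (lam : G →* (Z ≃ₗᵢ[ℝ] Z)) (v : Z →L[ℝ] Z) (z : Z)
    (φ : StrongDual ℝ Z) : BoundedContinuousFunction G ℝ :=
  BoundedContinuousFunction.ofNormedAddCommGroup (fun g => φ (lam g (v (lam g⁻¹ z))))
    continuous_of_discreteTopology (‖v‖ * ‖z‖ * ‖φ‖) (norm_apply_conjugate_le lam v z φ)

@[simp]
theorem conjugateCoeff_apply (lam : G →* (Z ≃ₗᵢ[ℝ] Z)) (v : Z →L[ℝ] Z) (z : Z)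
    (φ : StrongDual ℝ Z) (g : G) :
    conjugateCoeff lam v z φ g = φ (lam g (v (lam g⁻¹ z))) := rfl

theorem norm_conjugateCoeff_le (lam : G →* (Z ≃ₗᵢ[ℝ] Z)) (v : Z →L[ℝ] Z) (z : Z)
    (φ : StrongDual ℝ Z) : ‖conjugateCoeff lam v z φ‖ ≤ ‖v‖ * ‖z‖ * ‖φ‖ :=
  (BoundedContinuousFunction.norm_le (by positivity)).mpr (norm_apply_conjugate_le lam v z φ)

/-- The coefficient function as a bilinear map. -/
noncomputable def conjugateCoeffₗ (lam : G →* (Z ≃ₗᵢ[ℝ] Z)) (v : Z →L[ℝ] Z) :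
    Z →ₗ[ℝ] StrongDual ℝ Z →ₗ[ℝ] BoundedContinuousFunction G ℝ :=
  LinearMap.mk₂ ℝ (conjugateCoeff lam v)
    (fun _ _ _ => by ext; simp) (fun _ _ _ => by ext; simp)
    (fun _ _ _ => by ext; simp) (fun _ _ _ => by ext; simp)

/-- On a reflexive space, a mean averages the conjugates of an operator to an operator of no
larger norm. -/
theorem exists_average_conjugate
    (hrefl : Function.Surjective (NormedSpace.inclusionInDoubleDual ℝ Z))
    (m : BoundedContinuousFunction G ℝ →ₗ[ℝ] ℝ) (hm1 : m 1 = 1)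
    (hmpos : ∀ f : BoundedContinuousFunction G ℝ, (∀ g, 0 ≤ f g) → 0 ≤ m f)
    (lam : G →* (Z ≃ₗᵢ[ℝ] Z)) (v : Z →L[ℝ] Z) :
    ∃ w : Z →L[ℝ] Z, ‖w‖ ≤ ‖v‖ ∧
      ∀ (z : Z) (φ : StrongDual ℝ Z), φ (w z) = m (conjugateCoeff lam v z φ) := by
  let e := LinearIsometryEquiv.ofSurjective (NormedSpace.inclusionInDoubleDualLi (E := Z) ℝ) hrefl
  have hbound (z : Z) (φ : StrongDual ℝ Z) :
      ‖(conjugateCoeffₗ lam v).compr₂ m z φ‖ ≤ ‖v‖ * ‖z‖ * ‖φ‖ :=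
    (abs_mean_le_norm m hm1 hmpos _).trans (norm_conjugateCoeff_le lam v z φ)
  let B : Z →ₗ[ℝ] StrongDual ℝ (StrongDual ℝ Z) :=
    { toFun := fun z => ((conjugateCoeffₗ lam v).compr₂ m z).mkContinuous (‖v‖ * ‖z‖) (hbound z)
      map_add' := fun _ _ => by ext; simp
      map_smul' := fun _ _ => by ext; simp }
  have hB (z : Z) : ‖e.symm (B z)‖ ≤ ‖v‖ * ‖z‖ :=
    (e.symm.norm_map (B z)).trans_le (LinearMap.mkContinuous_norm_le _ (by positivity) (hbound z))
  refine ⟨(e.symm.toLinearEquiv.toLinearMap ∘ₗ B).mkContinuous ‖v‖ hB,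
    LinearMap.mkContinuous_norm_le _ (norm_nonneg v) hB, fun z φ => ?_⟩
  exact DFunLike.congr_fun (e.apply_symm_apply (B z)) φ

end ConjugateAverage

/-- Let `Z` be a reflexive real Banach space (the canonical embedding
into the bidual is surjective), `G` a group (with the discrete topology) admitting a
left-invariant mean `m` on bounded real-valued functions, and `lam : G → Isom(Z)` a
group homomorphism into the group of surjective linear isometries of `Z`.  If
`X ⊆ Z` is a closed `lam`-invariant subspace and `v : Z → Z` is a bounded linear map
whose restriction to `X` is a multiplier, then there exists a bounded linear map
`w : Z → Z` with `‖w‖ ≤ ‖v‖` which is a multiplier on all of `Z` and agrees with `v`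
on `X`. -/
theorem multiplier_extension_of_reflexive
    (Z : Type*) [NormedAddCommGroup Z] [NormedSpace ℝ Z] [CompleteSpace Z]
    (hrefl : Function.Surjective (NormedSpace.inclusionInDoubleDual ℝ Z))
    (G : Type*) [Group G] [TopologicalSpace G] [DiscreteTopology G]
    (m : BoundedContinuousFunction G ℝ →ₗ[ℝ] ℝ)
    (hm1 : m 1 = 1)
    (hmpos : ∀ f : BoundedContinuousFunction G ℝ, (∀ g, 0 ≤ f g) → 0 ≤ m f)
    (hminv : ∀ (h : G) (f : BoundedContinuousFunction G ℝ),
      m (f.compContinuous ⟨fun g => h * g, continuous_of_discreteTopology⟩) = m f)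
    (lam : G →* (Z ≃ₗᵢ[ℝ] Z))
    (X : Submodule ℝ Z) (hXclosed : IsClosed (X : Set Z))
    (hXinv : ∀ g : G, ∀ x ∈ X, lam g x ∈ X)
    (v : Z →L[ℝ] Z)
    (hv : ∀ g : G, ∀ x ∈ X, lam g (v x) = v (lam g x)) :
    ∃ w : Z →L[ℝ] Z, ‖w‖ ≤ ‖v‖ ∧
      (∀ g : G, ∀ z : Z, lam g (w z) = w (lam g z)) ∧
      ∀ x ∈ X, w x = v x := by
  obtain ⟨w, hw, hwm⟩ := exists_average_conjugate hrefl m hm1 hmpos lam v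
  refine ⟨w, hw, fun h z => ?_, fun x hx => ?_⟩
  · refine (SeparatingDual.eq_iff_forall_dual_eq (R := ℝ)).mpr fun φ => ?_
    rw [hwm, ← hminv h]
    refine (hwm z (φ.comp (lam h : Z →L[ℝ] Z))).trans (congrArg m ?_)
    ext g
    simp
  · refine (SeparatingDual.eq_iff_forall_dual_eq (R := ℝ)).mpr fun φ => ?_
    have hconst : conjugateCoeff lam v x φ = φ (v x) • (1 : BoundedContinuousFunction G ℝ) := by
      ext g
      rw [conjugateCoeff_apply, hv g _ (hXinv g⁻¹ x hx)]
      simp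
    rw [hwm, hconst, map_smul, hm1, smul_eq_mul, mul_one]
end

section
/- Let A be an associative unital ℂ-algebra, let n ≥ 1, and let s_1, …, s_{2n} be an anticommuting family of square roots of unity in A. Set w = s_1 s_2 ⋯ s_{2n}. Then for all complex numbers α, γ and β_1, …, β_{2n}, setting x = α·1 + Σ_{j=1}^{2n} β_j s_j + γ·w, one has x − Σ_{j=1}^{2n} s_j x s_j − (−1)^n w x w = 2n·(−α·1 + Σ_{j=1}^{2n} β_j s_j + γ·w). (This is the identity 2n·τ_Θ = π_0 − Σ_{j=1}^{2n+1} π_j on the spin factor F_n, used to bound the completely bounded norm of the transpose map by (n+1)/n.) -/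
/-- An element anticommuting with every entry of a list commutes with the product up to the sign
given by the length of the list. -/
theorem mul_list_prod_of_anticommute {A : Type*} [Ring A] (a : A) (l : List A)
    (h : ∀ b ∈ l, a * b = -(b * a)) :
    a * l.prod = (-1 : ℤ) ^ l.length • (l.prod * a) := by
  induction l with
  | nil => simp
  | cons b l ih =>
    have hl := ih fun c hc => h c (List.mem_cons_of_mem _ hc)
    rw [List.prod_cons, ← mul_assoc, h b List.mem_cons_self, neg_mul, mul_assoc, hl,
      mul_smul_comm, List.length_cons, pow_succ, mul_neg_one, neg_smul, mul_assoc]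

/-- A member of an anticommuting family commutes with a product of distinct members that includes
it, up to the sign `(-1) ^ (length + 1)`. -/
theorem mul_list_prod_of_mem_of_anticommute {A ι : Type*} [Ring A] (s : ι → A)
    (hanti : ∀ j k, j ≠ k → s j * s k = -(s k * s j)) {l : List ι} (hl : l.Nodup) {j : ι}
    (hj : j ∈ l) :
    s j * (l.map s).prod = (-1 : ℤ) ^ (l.length + 1) • ((l.map s).prod * s j) := by
  induction l with
  | nil => simp at hj
  | cons k l ih =>
    obtain ⟨hk, hl⟩ := List.nodup_cons.mp hl
    rw [List.map_cons, List.prod_cons, List.length_cons]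
    rcases List.mem_cons.mp hj with rfl | hjl
    · have hcomm : s j * (l.map s).prod = (-1 : ℤ) ^ l.length • ((l.map s).prod * s j) := by
        simpa using mul_list_prod_of_anticommute (s j) (l.map s) (by
          simp only [List.mem_map, forall_exists_index, and_imp, forall_apply_eq_imp_iff₂]
          exact fun k hkl => hanti j k fun h => hk (h ▸ hkl))
      nth_rewrite 1 [hcomm]
      rw [mul_smul_comm, mul_assoc, pow_add, pow_add]
      simp
    · have hjk : j ≠ k := fun h => hk (h ▸ hjl)
      rw [← mul_assoc, hanti j k hjk, neg_mul, mul_assoc, ih hl hjl, mul_smul_comm,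
        pow_succ _ (l.length + 1), mul_neg_one, neg_smul, mul_assoc]

/-- The square of a product of distinct members of an anticommuting family of square roots of
unity. -/
theorem list_prod_mul_self_of_anticommute {A ι : Type*} [Ring A] (s : ι → A)
    (hsq : ∀ j, s j * s j = 1)
    (hanti : ∀ j k, j ≠ k → s j * s k = -(s k * s j)) {l : List ι} (hl : l.Nodup) :
    (l.map s).prod * (l.map s).prod = (-1 : ℤ) ^ l.length.choose 2 • (1 : A) := by
  induction l with
  | nil => simp
  | cons k l ih =>
    obtain ⟨hk, hl⟩ := List.nodup_cons.mp hl
    have hcomm : s k * (l.map s).prod = (-1 : ℤ) ^ l.length • ((l.map s).prod * s k) := by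
      simpa using mul_list_prod_of_anticommute (s k) (l.map s) (by
        simp only [List.mem_map, forall_exists_index, and_imp, forall_apply_eq_imp_iff₂]
        exact fun j hj => hanti k j fun h => hk (h ▸ hj))
    rw [List.map_cons, List.prod_cons, List.length_cons, Nat.choose_succ_succ' l.length 1,
      Nat.choose_one_right]
    nth_rewrite 1 [hcomm]
    rw [smul_mul_assoc, mul_assoc, ← mul_assoc (s k), hsq, one_mul, ih hl, smul_smul, pow_add]

/-- Conjugating a member of an anticommuting family of square roots of unity by all members of the
family and summing. -/
theorem sum_mul_mul_of_anticommute {A ι : Type*} [Ring A] [Fintype ι] (s : ι → A)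
    (hsq : ∀ j, s j * s j = 1) (hanti : ∀ j k, j ≠ k → s j * s k = -(s k * s j)) (k : ι) :
    ∑ j, s j * s k * s j = (2 - Fintype.card ι : ℤ) • s k := by
  classical
  have hterm : ∀ j, s j * s k * s j = (if j = k then 2 • s k else 0) - s k := by
    intro j
    split_ifs with h
    · rw [h, hsq, one_mul, two_smul, add_sub_cancel_right]
    · rw [hanti j k h, neg_mul, mul_assoc, hsq, mul_one, zero_sub]
  simp_rw [hterm, Finset.sum_sub_distrib]
  simp [sub_smul]

/-- Let `A` be an associative unital `ℂ`-algebra, `n ≥ 1`, and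
`s 1, …, s (2n)` an anticommuting family of square roots of unity in `A`.  Set
`w = s 1 * s 2 * ⋯ * s (2n)`.  Then for all complex `α, γ` and `β 1, …, β (2n)`,
with `x = α • 1 + ∑ j, β j • s j + γ • w`, one has
`x - ∑ j, s j * x * s j - (-1)^n * (w * x * w) = (2n) • (-α • 1 + ∑ j, β j • s j + γ • w)`.
(The identity `2n • τ_Θ = π₀ - ∑_{j=1}^{2n+1} π_j` on the spin factor `F_n`.) -/
theorem spin_factor_transpose_identity
    {A : Type*} [Ring A] [Algebra ℂ A]
    (n : ℕ) (hn : 1 ≤ n) (s : Fin (2 * n) → A)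
    (hsq : ∀ j, s j * s j = 1)
    (hanti : ∀ j k, j ≠ k → s j * s k = -(s k * s j))
    (α γ : ℂ) (β : Fin (2 * n) → ℂ) :
    let w : A := (List.ofFn s).prod
    let x : A := α • (1 : A) + (∑ j, β j • s j) + γ • w
    x - (∑ j, s j * x * s j) - (-1 : A) ^ n * (w * x * w) =
      ((2 * n : ℕ) : ℂ) • (-(α • (1 : A)) + (∑ j, β j • s j) + γ • w) := by
  intro w x
  have hw : w = ((List.finRange (2 * n)).map s).prod := by
    simp only [w, List.ofFn_eq_map]
  have hnodup := List.nodup_finRange (2 * n)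
  have hsw : ∀ j, s j * w = -(w * s j) := by
    intro j
    rw [hw, mul_list_prod_of_mem_of_anticommute s hanti hnodup (List.mem_finRange j)]
    simp [pow_succ, pow_mul]
  have hww : w * w = (-1 : A) ^ n := by
    have hchoose : (2 * n).choose 2 = n * (2 * n - 1) := by
      rw [Nat.choose_two_right, mul_assoc, Nat.mul_div_cancel_left _ two_pos]
    have hodd : Odd (2 * n - 1) := ⟨n - 1, by omega⟩
    rw [hw, list_prod_mul_self_of_anticommute s hsq hanti hnodup, List.length_finRange, hchoose,
      mul_comm n, pow_mul, hodd.neg_one_pow]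
    simp
  have hsign : (-1 : A) ^ n * (-1 : A) ^ n = 1 := by
    rw [← pow_add, ← two_mul, pow_mul, neg_one_sq, one_pow]
  have hwsw : ∀ j, w * s j * w = -((-1 : A) ^ n * s j) := by
    intro j
    rw [mul_assoc, hsw, mul_neg, ← mul_assoc, hww]
  have hwxw : (-1 : A) ^ n * (w * x * w) = α • (1 : A) - (∑ j, β j • s j) + γ • w := by
    simp only [x, mul_add, add_mul, Finset.mul_sum, Finset.sum_mul, mul_smul_comm,
      smul_mul_assoc, mul_one, hwsw, hww, mul_neg, ← mul_assoc, hsign, one_mul, smul_neg,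
      Finset.sum_neg_distrib, sub_eq_add_neg]
  have hsws : ∀ j, s j * w * s j = -w := by
    intro j
    rw [hsw, neg_mul, mul_assoc, hsq, mul_one]
  have hsum : ∑ j, s j * (∑ k, β k • s k) * s j =
      (2 - (2 * n : ℕ) : ℤ) • ∑ k, β k • s k := by
    simp only [Finset.mul_sum, Finset.sum_mul, mul_smul_comm, smul_mul_assoc]
    rw [Finset.sum_comm]
    simp_rw [← Finset.smul_sum, sum_mul_mul_of_anticommute s hsq hanti, Fintype.card_fin]
    rw [Finset.smul_sum]
    exact Finset.sum_congr rfl fun k _ => smul_comm _ _ _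
  have hsxs : ∑ j, s j * x * s j = (2 * n) • (α • (1 : A)) +
      (2 - (2 * n : ℕ) : ℤ) • (∑ j, β j • s j) - (2 * n) • (γ • w) := by
    simp only [x, mul_add, add_mul, Finset.sum_add_distrib, hsum]
    simp [hsq, hsws, sub_eq_add_neg]
  rw [hwxw, hsxs, Nat.cast_smul_eq_nsmul]
  simp only [x]
  module
end

section
/- Let n ≥ 1 and, for an integer N ≥ 1, let Q_N denote the quadratic form on ℂ^N given by Q_N(x) = x_1^2 + ⋯ + x_N^2. Then there is an isomorphism of unital ℂ-algebras Cl(Q_{2n+1}) ≅ Cl(Q_{2n}) × Cl(Q_{2n}) between the Clifford algebra of Q_{2n+1} and the direct product of two copies of the Clifford algebra of Q_{2n}. -/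
namespace CliffordAlgebra

section Splitting

variable {R M : Type*} [CommRing R] [AddCommGroup M] [Module R M] {Q : QuadraticForm R M}

/-- The generator of `CliffordAlgebra (QuadraticMap.sq.prod Q)` coming from the first summand
anticommutes with the generators of `CliffordAlgebra Q`, hence twists by the grade involution. -/
theorem ι_inl_mul_map_inr (a : CliffordAlgebra Q) :
    ι ((QuadraticMap.sq (R := R)).prod Q) (1, 0) * map (QuadraticMap.Isometry.inr _ Q) a =
      map (QuadraticMap.Isometry.inr _ Q) (involute a) *
        ι ((QuadraticMap.sq (R := R)).prod Q) (1, 0) := by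
  induction a using CliffordAlgebra.induction with
  | algebraMap r => simp only [AlgHom.commutes, Algebra.commutes]
  | ι m =>
    rw [involute_ι, map_neg, map_apply_ι, neg_mul]
    exact ι_mul_ι_comm_of_isOrtho (by simp [QuadraticMap.isOrtho_def])
  | add a b ha hb => simp only [map_add, mul_add, add_mul, ha, hb]
  | mul a b ha hb =>
    simp only [map_mul]
    rw [← mul_assoc, ha, mul_assoc, hb, mul_assoc]

/-- The homomorphism from the product of two copies of an algebra defined by a homomorphism and an
idempotent commuting with its image. -/
def _root_.AlgHom.prodOfIdempotent {A B : Type*} [Ring A] [Ring B] [Algebra R A] [Algebra R B]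
    (f : A →ₐ[R] B) (p : B) (hp : IsIdempotentElem p) (hpf : ∀ a, Commute p (f a)) :
    A × A →ₐ[R] B :=
  AlgHom.ofLinearMap
    ((LinearMap.mulRight R p ∘ₗ f.toLinearMap).coprod
      (LinearMap.mulRight R (1 - p) ∘ₗ f.toLinearMap))
    (by simp)
    (by
      rintro ⟨a, b⟩ ⟨c, d⟩
      simp only [Prod.mk_mul_mk, LinearMap.coprod_apply, LinearMap.comp_apply,
        LinearMap.mulRight_apply, AlgHom.toLinearMap_apply, map_mul, mul_add, add_mul]
      have key (x y : A) (s t : B) (h : ∀ a, Commute s (f a)) :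
          f x * s * (f y * t) = f x * f y * (s * t) := by
        rw [mul_assoc, ← mul_assoc s, (h y).eq]; simp only [mul_assoc]
      simp only [key _ _ _ _ hpf, key _ _ _ _ fun a => (Commute.one_left _).sub_left (hpf a),
        hp.eq, hp.one_sub.eq, hp.mul_one_sub_self, hp.one_sub_mul_self, mul_zero, add_zero,
        zero_add])

/-- If `w` is an even square root of `1` anticommuting with all vectors, adjoining one further
orthogonal vector of square `1` to the form doubles the Clifford algebra. -/
theorem nonempty_sq_prod_algEquiv [Invertible (2 : R)] (w : CliffordAlgebra Q) (hw : w * w = 1)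
    (hinv : involute w = w) (hι : ∀ m, ι Q m * w = -(w * ι Q m)) :
    Nonempty (CliffordAlgebra ((QuadraticMap.sq (R := R)).prod Q) ≃ₐ[R]
      CliffordAlgebra Q × CliffordAlgebra Q) := by
  set i := map (QuadraticMap.Isometry.inr (QuadraticMap.sq (R := R)) Q) with hi
  set e := ι ((QuadraticMap.sq (R := R)).prod Q) (1, 0) with he
  have hee : e * e = 1 := by rw [he, ι_sq_scalar]; simp
  have hew : e * i w = i w * e := by rw [ι_inl_mul_map_inr, hinv]
  have hwa (a : CliffordAlgebra Q) : a * w = w * involute a := by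
    induction a using CliffordAlgebra.induction with
    | algebraMap r => rw [AlgHom.commutes, Algebra.commutes]
    | ι m => rw [hι, involute_ι, mul_neg]
    | add a b ha hb => simp only [map_add, mul_add, add_mul, ha, hb]
    | mul a b ha hb => rw [mul_assoc, hb, ← mul_assoc, ha, map_mul, mul_assoc]
  set z := i w * e with hz
  have hzz : z * z = 1 := by
    rw [hz, mul_assoc, ← mul_assoc e, hew, mul_assoc, hee, mul_one, ← map_mul, hw, map_one]
  have hzi (a : CliffordAlgebra Q) : Commute z (i a) := by
    change i w * e * i a = i a * (i w * e)
    rw [mul_assoc, ι_inl_mul_map_inr, ← mul_assoc, ← mul_assoc, ← map_mul, ← map_mul, hwa]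
  let p := (⅟2 : R) • (1 + z)
  have hp : IsIdempotentElem p := by
    have : (1 + z) * (1 + z) = (2 : R) • (1 + z) := by
      rw [two_smul, add_mul, one_mul, mul_add, mul_one, hzz, add_comm z]
    simp only [IsIdempotentElem, p, smul_mul_smul_comm, this, smul_smul, mul_assoc,
      invOf_mul_self, mul_one]
  have hpz : p - (1 - p) = z := by
    rw [sub_sub_eq_add_sub, ← two_smul R p, smul_smul, mul_invOf_self, one_smul,
      add_sub_cancel_left]
  let G := AlgHom.prodOfIdempotent i p hp
    (fun a => ((Commute.one_left _).add_left (hzi a)).smul_left _)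
  have hG (a b : CliffordAlgebra Q) : G (a, b) = i a * p + i b * (1 - p) := rfl
  let f : R × M →ₗ[R] CliffordAlgebra Q × CliffordAlgebra Q :=
    (LinearMap.toSpanSingleton R _ (w, -w)).coprod ((ι Q).prod (ι Q))
  have hf (r : R) (m : M) : f (r, m) = (r • w + ι Q m, -(r • w) + ι Q m) := by simp [f]
  let F := lift ((QuadraticMap.sq (R := R)).prod Q) ⟨f, by
    rintro ⟨r, m⟩
    have hm := ι_sq_scalar Q m
    rw [hf, Prod.mk_mul_mk, Prod.algebraMap_apply, QuadraticMap.prod_apply, map_add]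
    simp only [mul_add, add_mul, smul_mul_assoc, mul_smul_comm, hw, hm, hι, neg_mul, mul_neg,
      smul_add, smul_neg, QuadraticMap.sq_apply, Algebra.algebraMap_eq_smul_one, mul_smul]
    ext <;> simp only <;> abel⟩
  have hFι (r : R) (m : M) : F (ι _ (r, m)) = (r • w + ι Q m, -(r • w) + ι Q m) := by
    rw [lift_ι_apply, hf]
  have hFi (a : CliffordAlgebra Q) : F (i a) = (a, a) := by
    have : F.comp i = (AlgHom.id R _).prod (AlgHom.id R _) := by
      ext m <;> simp [hi, hFι]
    exact DFunLike.congr_fun this a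
  have hFz : F z = (1, -1) := by
    rw [hz, map_mul, hFi, he, hFι]
    simp [hw]
  refine ⟨AlgEquiv.ofAlgHom F G (AlgHom.ext ?_) (CliffordAlgebra.hom_ext (LinearMap.ext ?_))⟩
  · rintro ⟨a, b⟩
    have hFp : F p = (1, 0) := by
      simp only [p, map_smul, map_add, map_one, hFz]
      ext <;> simp
    rw [AlgHom.comp_apply, hG]
    ext <;> simp [hFi, hFp]
  · rintro ⟨r, m⟩
    have hιrm : ι ((QuadraticMap.sq (R := R)).prod Q) (r, m) = r • e + i (ι Q m) := by
      rw [he, hi, map_apply_ι, ← map_smul, ← map_add]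
      simp
    have hwz : i w * z = e := by rw [hz, ← mul_assoc, ← map_mul, hw, map_one, one_mul]
    have : G (F (ι _ (r, m))) = ι _ (r, m) := by
      rw [hFι, hG, hιrm, ← hwz, ← hpz]
      simp only [map_add, map_neg, map_smul, add_mul, mul_sub, mul_one, smul_sub, neg_mul,
        smul_mul_assoc]
      abel
    exact this

end Splitting

section Anticommuting

variable {κ A : Type*} [Ring A] {e : κ → A}

theorem mul_prod_map_of_notMem (hanti : ∀ i j, i ≠ j → e i * e j = -(e j * e i)) {j : κ}
    {l : List κ} (hj : j ∉ l) :
    e j * (l.map e).prod = (-1) ^ l.length * ((l.map e).prod * e j) := by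
  induction l with
  | nil => simp
  | cons k l ih =>
    rw [List.mem_cons, not_or] at hj
    rw [List.map_cons, List.prod_cons, ← mul_assoc, hanti j k hj.1, neg_mul, mul_assoc, ih hj.2,
      List.length_cons, pow_succ, ← mul_assoc, ← ((Commute.neg_one_left (e k)).pow_left _).eq]
    noncomm_ring

theorem mul_prod_map_of_mem (hanti : ∀ i j, i ≠ j → e i * e j = -(e j * e i)) {j : κ}
    {l : List κ} (hl : l.Nodup) (hj : j ∈ l) :
    e j * (l.map e).prod = (-1) ^ (l.length + 1) * ((l.map e).prod * e j) := by
  induction l with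
  | nil => simp at hj
  | cons k l ih =>
    rw [List.nodup_cons] at hl
    rw [List.map_cons, List.prod_cons, List.length_cons]
    have hc := ((Commute.neg_one_left (e k)).pow_left l.length).eq
    rcases eq_or_ne j k with rfl | hjk
    · have h := mul_prod_map_of_notMem hanti hl.1
      rw [mul_assoc (e j) _ (e j), h, ← mul_assoc (e j), ← hc, pow_succ, pow_succ, mul_assoc]
      simp
    · have h := ih hl.2 ((List.mem_cons.mp hj).resolve_left hjk)
      rw [← mul_assoc, hanti j k hjk, neg_mul, mul_assoc, h, pow_succ, ← mul_assoc, ← mul_assoc,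
        ← mul_assoc, ← hc, pow_succ, pow_succ]
      noncomm_ring

theorem prod_map_mul_self (hsq : ∀ i, e i * e i = 1)
    (hanti : ∀ i j, i ≠ j → e i * e j = -(e j * e i)) {l : List κ} (hl : l.Nodup) :
    (l.map e).prod * (l.map e).prod = 1 ∨ (l.map e).prod * (l.map e).prod = -1 := by
  induction l with
  | nil => simp
  | cons k l ih =>
    rw [List.nodup_cons] at hl
    have h := mul_prod_map_of_notMem hanti hl.1
    have key : (e k * (l.map e).prod) * (e k * (l.map e).prod) =
        (-1) ^ l.length * ((l.map e).prod * (l.map e).prod) := by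
      nth_rewrite 1 [h]
      simp only [mul_assoc]
      rw [← mul_assoc (e k) (e k), hsq, one_mul]
    rw [List.map_cons, List.prod_cons, key]
    rcases neg_one_pow_eq_or A l.length with hs | hs <;> rcases ih hl.2 with hp | hp <;>
      simp [hs, hp]

end Anticommuting

/-- The normalized volume element of an even-dimensional sum of squares over `ℂ`. -/
theorem exists_volume_element (n : ℕ) :
    ∃ w : CliffordAlgebra (QuadraticMap.weightedSumSquares ℂ (fun _ : Fin (2 * n) => (1 : ℂ))),
      w * w = 1 ∧ involute w = w ∧ ∀ m, ι _ m * w = -(w * ι _ m) := by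
  set Q := QuadraticMap.weightedSumSquares ℂ (fun _ : Fin (2 * n) => (1 : ℂ)) with hQ
  let e (i : Fin (2 * n)) : CliffordAlgebra Q := ι Q (Pi.single i 1)
  have hsq (i) : e i * e i = 1 := by
    simp only [e, ι_sq_scalar, hQ, QuadraticMap.weightedSumSquares_apply]
    simp [Pi.single_apply]
  have hanti (i j) (hij : i ≠ j) : e i * e j = -(e j * e i) := by
    refine ι_mul_ι_comm_of_isOrtho ?_
    simp only [QuadraticMap.isOrtho_def, hQ, QuadraticMap.weightedSumSquares_apply, one_smul,
      ← Finset.sum_add_distrib]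
    refine Finset.sum_congr rfl fun k _ => ?_
    by_cases hi : k = i <;> by_cases hj : k = j <;> simp_all
  set p := ((List.finRange (2 * n)).map e).prod with hp
  have hpι (m) : ι Q m * p = -(p * ι Q m) := by
    have : LinearMap.mulRight ℂ p ∘ₗ ι Q = -(LinearMap.mulLeft ℂ p ∘ₗ ι Q) := by
      refine LinearMap.pi_ext' fun i => LinearMap.ext_ring ?_
      have := mul_prod_map_of_mem hanti (List.nodup_finRange _) (List.mem_finRange i)
      rw [List.length_finRange, (odd_two_mul_add_one n).neg_one_pow, neg_one_mul] at this
      exact this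
    exact DFunLike.congr_fun this m
  have hpinv : involute p = p := by
    have := involute_prod_map_ι (Q := Q)
      ((List.finRange (2 * n)).map fun i => (Pi.single i 1 : Fin (2 * n) → ℂ))
    rwa [List.length_map, List.length_finRange, (even_two_mul n).neg_one_pow, one_smul,
      List.map_map] at this
  obtain ⟨c, hc⟩ : ∃ c : ℂ, (c * c) • (p * p) = 1 := by
    rcases prod_map_mul_self hsq hanti (List.nodup_finRange (2 * n)) with h | h
    · exact ⟨1, by rw [hp, h]; simp⟩
    · exact ⟨Complex.I, by rw [hp, h]; simp⟩
  refine ⟨c • p, by rw [smul_mul_smul_comm, hc], by rw [map_smul, hpinv], fun m => ?_⟩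
  rw [mul_smul_comm, hpι, smul_mul_assoc, smul_neg]

/-- Splitting off the first coordinate of a sum of squares. -/
def sqProdIsometryEquivSumSquares (R : Type*) [CommRing R] (N : ℕ) :
    ((QuadraticMap.sq (R := R)).prod
      (QuadraticMap.weightedSumSquares R (fun _ : Fin N => (1 : R)))).IsometryEquiv
      (QuadraticMap.weightedSumSquares R (fun _ : Fin (N + 1) => (1 : R))) where
  __ := Fin.consLinearEquiv R (fun _ : Fin (N + 1) => R)
  map_app' x := by
    change QuadraticMap.weightedSumSquares R (fun _ : Fin (N + 1) => (1 : R))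
      (Fin.cons x.1 x.2 : Fin (N + 1) → R) = _
    simp [QuadraticMap.weightedSumSquares_apply, Fin.sum_univ_succ]

end CliffordAlgebra

/-- Let `n ≥ 1` and, for `N ≥ 1`, let `Q_N` be the quadratic form
`Q_N x = x 1 ^ 2 + ⋯ + x N ^ 2` on `ℂ^N`.  Then there is an isomorphism of unital
`ℂ`-algebras `Cl(Q_{2n+1}) ≅ Cl(Q_{2n}) × Cl(Q_{2n})`. -/
theorem clifford_odd_splits
    (n : ℕ) (hn : 1 ≤ n) :
    Nonempty
      (CliffordAlgebra
          (QuadraticMap.weightedSumSquares ℂ (fun _ : Fin (2 * n + 1) => (1 : ℂ))) ≃ₐ[ℂ]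
        (CliffordAlgebra
            (QuadraticMap.weightedSumSquares ℂ (fun _ : Fin (2 * n) => (1 : ℂ))) ×
          CliffordAlgebra
            (QuadraticMap.weightedSumSquares ℂ (fun _ : Fin (2 * n) => (1 : ℂ))))) := by
  obtain ⟨w, hw, hinv, hι⟩ := CliffordAlgebra.exists_volume_element n
  obtain ⟨f⟩ := CliffordAlgebra.nonempty_sq_prod_algEquiv w hw hinv hι
  exact ⟨(CliffordAlgebra.equivOfIsometry
    (CliffordAlgebra.sqProdIsometryEquivSumSquares ℂ (2 * n))).symm.trans f⟩
end
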